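/- Let V be a real vector space and let b, a, ã : V × V → ℝ be symmetric bilinear forms with b positive definite, a and ã positive semidefinite, and ã(u, u) ≤ a(u, u) for all u ∈ V. Write ‖v‖_b = √(b(v,v)) and ‖v‖_ã = √(ã(v,v)). Let W ⊆ V be a subspace, Π̃ : V → W a linear map with ã(u − Π̃u, w) = 0 for all u ∈ V, w ∈ W, and C ≥ 0 a constant with ‖u − Π̃u‖_b ≤ C ‖u − Π̃u‖_ã for all u ∈ V. Suppose ũ₀ ∈ V, ũ₀ ≠ 0, and λ̃ ≥ 0 satisfy ã(ũ₀, v) = λ̃ b(ũ₀, v) for all v ∈ V and λ̃ ≤ ã(u,u)/b(u,u) for every nonzero u ∈ V. Assume W contains a nonzero element and let λ̃_h = inf over nonzero w ∈ W of ã(w,w)/b(w,w), and let λ₁ = inf over nonzero u ∈ V of a(u,u)/b(u,u). Then λ̃_h / (1 + λ̃_h C²) ≤ λ₁. -/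

import Mathlib

/-- The first discrete eigenvalue of the form pair `(ã, b)` on the subspace `W`:
the infimum of the Rayleigh quotient over nonzero elements of `W`. -/
noncomputable def discreteFirstEigenvalue {V : Type*} [AddCommGroup V] [Module ℝ V]
    (ta b : V →ₗ[ℝ] V →ₗ[ℝ] ℝ) (W : Submodule ℝ V) : ℝ :=
  sInf {r : ℝ | ∃ w ∈ W, w ≠ 0 ∧ r = ta w w / b w w}

/-- The first exact eigenvalue of the form pair `(a, b)` on `V`: the infimum of the
Rayleigh quotient over all nonzero elements of `V`. -/
noncomputable def firstEigenvalue {V : Type*} [AddCommGroup V] [Module ℝ V]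
    (a b : V →ₗ[ℝ] V →ₗ[ℝ] ℝ) : ℝ :=
  sInf {r : ℝ | ∃ u : V, u ≠ 0 ∧ r = a u u / b u u}

/-- The first discrete eigenvalue of nonnegative forms is nonnegative. -/
theorem discreteFirstEigenvalue_nonneg {V : Type*} [AddCommGroup V] [Module ℝ V]
    {ta b : V →ₗ[ℝ] V →ₗ[ℝ] ℝ} (W : Submodule ℝ V)
    (hb : ∀ v : V, v ≠ 0 → 0 < b v v) (hta : ∀ v : V, 0 ≤ ta v v) :
    0 ≤ discreteFirstEigenvalue ta b W := by
  apply Real.sInf_nonneg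
  rintro r ⟨w, -, hw, rfl⟩
  exact div_nonneg (hta w) (hb w hw).le

/-- The Rayleigh quotient of an element of `W` is at least the first discrete eigenvalue. -/
theorem discreteFirstEigenvalue_mul_le {V : Type*} [AddCommGroup V] [Module ℝ V]
    {ta b : V →ₗ[ℝ] V →ₗ[ℝ] ℝ} {W : Submodule ℝ V}
    (hb : ∀ v : V, v ≠ 0 → 0 < b v v) (hta : ∀ v : V, 0 ≤ ta v v) {w : V} (hw : w ∈ W) :
    discreteFirstEigenvalue ta b W * b w w ≤ ta w w := by
  by_cases h0 : w = 0
  · simp [h0]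
  · rw [← le_div_iff₀ (hb w h0)]
    refine csInf_le ⟨0, ?_⟩ ⟨w, hw, h0, rfl⟩
    rintro r ⟨v, -, hv, rfl⟩
    exact div_nonneg (hta v) (hb v hv).le

/-- If `L * b p p ≤ ta p p` and `b e e ≤ C ^ 2 * ta e e` for `ta`-orthogonal `p` and `e`, then
`p + e` satisfies the combined bound. -/
theorem mul_apply_add_le_of_orthogonal {V : Type*} [AddCommGroup V] [Module ℝ V]
    {ta b : V →ₗ[ℝ] V →ₗ[ℝ] ℝ} (hb_symm : ∀ u v : V, b u v = b v u)
    (hta_symm : ∀ u v : V, ta u v = ta v u) (hb : ∀ v : V, v ≠ 0 → 0 < b v v)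
    (hta : ∀ v : V, 0 ≤ ta v v) {L C : ℝ} (hL : 0 ≤ L) {p e : V}
    (hep : ta e p = 0) (hp : L * b p p ≤ ta p p) (he : b e e ≤ C ^ 2 * ta e e) :
    L * b (p + e) (p + e) ≤ (1 + L * C ^ 2) * ta (p + e) (p + e) := by
  have hb0 : ∀ v : V, 0 ≤ b v v := fun v ↦ by
    by_cases h : v = 0
    · simp [h]
    · exact (hb v h).le
  have hA : ta (p + e) (p + e) = ta p p + ta e e := by
    simp only [map_add, LinearMap.add_apply, hta_symm p e, hep]
    ring
  have hB : b (p + e) (p + e) = b p p + 2 * b p e + b e e := by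
    simp only [map_add, LinearMap.add_apply, hb_symm e p]
    ring
  obtain hs | hs := (mul_nonneg hL (sq_nonneg C)).eq_or_lt
  · rw [← hs, add_zero, one_mul]
    obtain h | h := mul_eq_zero.mp hs.symm
    · rw [h, zero_mul]
      exact hta _
    · have h0 : e = 0 := by
        by_contra hne
        have := hb e hne
        rw [h, zero_mul] at he
        linarith
      simpa [h0] using hp
  · set s := L * C ^ 2 with hs_def
    have hsq := hb0 (s • p - e)
    simp only [map_sub, map_smul, LinearMap.sub_apply, LinearMap.smul_apply, smul_eq_mul,
      hb_symm e p] at hsq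
    have hLe : L * b e e ≤ s * ta e e := by
      rw [hs_def, mul_assoc]
      exact mul_le_mul_of_nonneg_left he hL
    rw [hA, hB]
    refine le_of_mul_le_mul_left ?_ hs
    have h1 := mul_nonneg hL hsq
    have h2 := mul_le_mul_of_nonneg_left hp (by positivity : 0 ≤ s * (1 + s))
    have h3 := mul_le_mul_of_nonneg_left hLe (by positivity : 0 ≤ 1 + s)
    linear_combination h1 + h2 + h3

/-- Lower bound of Corollary 5.2 of the paper: if the auxiliary form `ã` is dominated by
`a` on the diagonal, `Π̃` is the `ã`-orthogonal projector onto `W` with projection-error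
constant `C`, and `(λ̃, ũ₀)` is the smallest exact eigenpair of `(ã, b)`, then the first
discrete eigenvalue `λ̃_h` of the auxiliary problem satisfies
`λ̃_h / (1 + λ̃_h C²) ≤ λ₁`, where `λ₁` is the first eigenvalue of `(a, b)`. -/
theorem auxiliary_lower_bound_first_eigenvalue
    {V : Type*} [AddCommGroup V] [Module ℝ V]
    (b a ta : V →ₗ[ℝ] V →ₗ[ℝ] ℝ)
    (hb_symm : ∀ u v : V, b u v = b v u)
    (ha_symm : ∀ u v : V, a u v = a v u)
    (hta_symm : ∀ u v : V, ta u v = ta v u)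
    (hb_pos : ∀ v : V, v ≠ 0 → 0 < b v v)
    (ha_pos : ∀ v : V, 0 ≤ a v v)
    (hta_pos : ∀ v : V, 0 ≤ ta v v)
    (hdom : ∀ u : V, ta u u ≤ a u u)
    (W : Submodule ℝ V) (proj : V →ₗ[ℝ] V) (hproj : ∀ u : V, proj u ∈ W)
    (hortho : ∀ u : V, ∀ w ∈ W, ta (u - proj u) w = 0)
    (C : ℝ) (hC : 0 ≤ C)
    (hest : ∀ u : V,
      Real.sqrt (b (u - proj u) (u - proj u)) ≤
        C * Real.sqrt (ta (u - proj u) (u - proj u)))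
    (tu₀ : V) (htu₀ : tu₀ ≠ 0) (tlam : ℝ) (htlam : 0 ≤ tlam)
    (hteig : ∀ v : V, ta tu₀ v = tlam * b tu₀ v)
    (htmin : ∀ u : V, u ≠ 0 → tlam ≤ ta u u / b u u)
    (hW : ∃ w ∈ W, w ≠ (0 : V)) :
    discreteFirstEigenvalue ta b W / (1 + discreteFirstEigenvalue ta b W * C ^ 2) ≤
      firstEigenvalue a b := by
  have hL := discreteFirstEigenvalue_nonneg W hb_pos hta_pos
  refine le_csInf ⟨_, tu₀, htu₀, rfl⟩ ?_
  rintro r ⟨u, hu, rfl⟩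
  have he : b (u - proj u) (u - proj u) ≤ C ^ 2 * ta (u - proj u) (u - proj u) := by
    have h := (Real.sqrt_le_left (by positivity)).mp (hest u)
    rwa [mul_pow, Real.sq_sqrt (hta_pos _)] at h
  have h := mul_apply_add_le_of_orthogonal hb_symm hta_symm hb_pos hta_pos hL
    (hortho u _ (hproj u)) (discreteFirstEigenvalue_mul_le hb_pos hta_pos (hproj u)) he
  rw [add_sub_cancel] at h
  have hpos : 0 < 1 + discreteFirstEigenvalue ta b W * C ^ 2 := by positivity
  rw [div_le_div_iff₀ hpos (hb_pos u hu), mul_comm (a u u)]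
  exact h.trans (mul_le_mul_of_nonneg_left (hdom u) hpos.le)
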